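/- For every rational t with 16t^4+64t^3+76t^2+24t-1 ≠ 0, setting k = 16t(t+1)(2t^2+4t+1)/(16t^4+64t^3+76t^2+24t-1), the quantity F(k,t) = [k^2(t+2)(2t+1)(2t+3) - 4k(t+1)(2t^2+4t+1) + t(2t+1)(2t+3)]^2 - k^2(4t^2+8t+3) is a square of a rational number. -/

import Mathlib

/-- `F k t` is the expression on the left-hand side of equation (1). -/
noncomputable def F (k t : ℚ) : ℚ :=
  (k ^ 2 * (t + 2) * (2 * t + 1) * (2 * t + 3) -
      4 * k * (t + 1) * (2 * t ^ 2 + 4 * t + 1) +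
      t * (2 * t + 1) * (2 * t + 3)) ^ 2 -
    k ^ 2 * (4 * t ^ 2 + 8 * t + 3)

theorem stmt_9 (t : ℚ) (ht : 16 * t ^ 4 + 64 * t ^ 3 + 76 * t ^ 2 + 24 * t - 1 ≠ 0)
    (k : ℚ)
    (hk : k = 16 * t * (t + 1) * (2 * t ^ 2 + 4 * t + 1) /
      (16 * t ^ 4 + 64 * t ^ 3 + 76 * t ^ 2 + 24 * t - 1)) :
    ∃ w : ℚ, F k t = w ^ 2 := by
  generalize hd : 16 * t ^ 4 + 64 * t ^ 3 + 76 * t ^ 2 + 24 * t - 1 = d at ht hk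
  refine ⟨t * (1024 * t ^ 10 + 10240 * t ^ 9 + 43264 * t ^ 8 + 100352 * t ^ 7 +
      138560 * t ^ 6 + 114560 * t ^ 5 + 52720 * t ^ 4 + 9664 * t ^ 3 -
      1476 * t ^ 2 - 776 * t - 61) / d ^ 2, ?_⟩
  rw [hk, F]
  field_simp
  rw [← hd]
  ring
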